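/- For every positive integer k, there exists an acyclic temporal network N = ((V ∪ {s}, A), τ) such that λ_N(s,v) ≥ k for all v ∈ V, and yet N contains no packing of 2 spanning τ-respecting s-arborescences. -/

import Mathlib

/-- A directed graph (possibly with parallel arcs): arc type `At`, vertex type `Vt`,
each arc has a tail and a head. -/
structure Dgraph (Vt At : Type) where
  tail : At → Vt
  head : At → Vt

namespace Dgraph

variable {Vt At : Type}

/-- `D.WalkFrom u p v` : the list of arcs `p` forms a directed walk from `u` to `v`. -/
def WalkFrom (D : Dgraph Vt At) : Vt → List At → Vt → Prop
  | u, [], v => u = v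
  | u, a :: p, v => D.tail a = u ∧ D.WalkFrom (D.head a) p v

/-- The vertices visited by a walk starting at `u` with arc list `p`. -/
def walkVerts (D : Dgraph Vt At) (u : Vt) (p : List At) : List Vt :=
  u :: p.map D.head

/-- A directed path from `u` to `v`: a walk visiting pairwise distinct vertices. -/
def IsPath (D : Dgraph Vt At) (u : Vt) (p : List At) (v : Vt) : Prop :=
  D.WalkFrom u p v ∧ (D.walkVerts u p).Nodup

/-- An arc list is τ-respecting if its τ-values are non-decreasing. -/
def Respects (τ : At → ℕ) (p : List At) : Prop :=
  List.Chain' (· ≤ ·) (p.map τ)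

/-- An arc list is monochromatic w.r.t. a colouring `c` if all its arcs get the same colour. -/
def Monochromatic (c : At → Bool) (p : List At) : Prop :=
  ∀ a ∈ p, ∀ b ∈ p, c a = c b

/-- There is no directed cycle using only arcs of `B`
(equivalently, no nonempty closed directed walk inside `B`). -/
def AcyclicOn (D : Dgraph Vt At) (B : Set At) : Prop :=
  ¬ ∃ (v : Vt) (p : List At), p ≠ [] ∧ (∀ a ∈ p, a ∈ B) ∧ D.WalkFrom v p v

/-- The directed graph contains no directed cycle. -/
def Acyclic (D : Dgraph Vt At) : Prop :=
  D.AcyclicOn Set.univ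

/-- `u` reaches `v` by a directed walk. -/
def Reaches (D : Dgraph Vt At) (u v : Vt) : Prop :=
  ∃ p : List At, D.WalkFrom u p v

/-- `u` and `v` are in the same strongly connected component. -/
def MutuallyReachable (D : Dgraph Vt At) (u v : Vt) : Prop :=
  D.Reaches u v ∧ D.Reaches v u

/-- A temporal network `(D, τ)` is consistent if any two arcs lying in the same strongly
connected component (i.e. whose endpoints are all mutually reachable) have the same τ-value. -/
def Consistent (D : Dgraph Vt At) (τ : At → ℕ) : Prop :=
  ∀ a b : At,
    D.MutuallyReachable (D.tail a) (D.head a) →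
    D.MutuallyReachable (D.tail b) (D.head b) →
    D.MutuallyReachable (D.tail a) (D.tail b) →
    τ a = τ b

section Fin

variable [DecidableEq Vt] [Fintype At]

/-- The vertex set of the subgraph with arc set `B`, together with the root `s`. -/
def vertsF (D : Dgraph Vt At) (s : Vt) (B : Finset At) : Finset Vt :=
  insert s (B.image D.tail ∪ B.image D.head)

/-- In-degree of `v` in the subgraph with arc set `B`. -/
def indegOn (D : Dgraph Vt At) (B : Finset At) (v : Vt) : ℕ :=
  (B.filter (fun a => D.head a = v)).card

/-- In-degree of `v`. -/
def indeg (D : Dgraph Vt At) (v : Vt) : ℕ :=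
  D.indegOn Finset.univ v

/-- Out-degree of `v`. -/
def outdeg (D : Dgraph Vt At) (v : Vt) : ℕ :=
  (Finset.univ.filter (fun a => D.tail a = v)).card

/-- `ρ^i_N(v)` : the set of arcs entering `v` with τ-value at most `i`. -/
def rhoLe (D : Dgraph Vt At) (τ : At → ℕ) (v : Vt) (i : ℕ) : Finset At :=
  Finset.univ.filter (fun a => D.head a = v ∧ τ a ≤ i)

/-- `δ^i_N(v)` : the set of arcs leaving `v` with τ-value at most `i`. -/
def deltaLe (D : Dgraph Vt At) (τ : At → ℕ) (v : Vt) (i : ℕ) : Finset At :=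
  Finset.univ.filter (fun a => D.tail a = v ∧ τ a ≤ i)

/-- The temporal network `(D, τ)` with root `s` is pre-flow:
`|ρ^i_N(v)| ≥ |δ^i_N(v)|` for every `i` and every non-root vertex `v`. -/
def Preflow (D : Dgraph Vt At) (τ : At → ℕ) (s : Vt) : Prop :=
  ∀ (i : ℕ) (v : Vt), v ≠ s → (D.deltaLe τ v i).card ≤ (D.rhoLe τ v i).card

/-- The arc set `B` induces an `s`-arborescence: the subgraph contains `s`,
has no directed cycle, and every vertex of it other than `s` has in-degree exactly 1. -/
def IsArb (D : Dgraph Vt At) (s : Vt) (B : Finset At) : Prop :=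
  D.AcyclicOn (↑B) ∧ ∀ v ∈ D.vertsF s B, v ≠ s → D.indegOn B v = 1

/-- The arc set `B` induces a τ-respecting `s`-arborescence: an `s`-arborescence in which,
for every vertex `v` of the arborescence, the (unique) path from `s` to `v` is τ-respecting. -/
def IsTArb (D : Dgraph Vt At) (τ : At → ℕ) (s : Vt) (B : Finset At) : Prop :=
  D.IsArb s B ∧
    ∀ v ∈ D.vertsF s B, ∀ p : List At, (∀ a ∈ p, a ∈ B) → D.IsPath s p v → Respects τ p

/-- There exist `k` pairwise arc-disjoint τ-respecting directed paths from `s` to `v`. -/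
def HasTPaths (D : Dgraph Vt At) (τ : At → ℕ) (s v : Vt) (k : ℕ) : Prop :=
  ∃ P : Fin k → List At,
    (∀ i, D.IsPath s (P i) v ∧ Respects τ (P i)) ∧
    ∀ i j, i ≠ j → ∀ a, a ∈ P i → a ∉ P j

/-- `λ_N(s,v)` : the maximum number of pairwise arc-disjoint τ-respecting `(s,v)`-paths. -/
noncomputable def lambdaT (D : Dgraph Vt At) (τ : At → ℕ) (s v : Vt) : ℕ :=
  sSup {k | D.HasTPaths τ s v k}

/-- `λ_D(s,v)` : the maximum number of pairwise arc-disjoint `(s,v)`-paths. -/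
noncomputable def lambda (D : Dgraph Vt At) (s v : Vt) : ℕ :=
  D.lambdaT (fun _ => 0) s v

end Fin

end Dgraph

namespace Dgraph

variable {Vt At : Type}

theorem respects_iff {τ : At → ℕ} {p : List At} :
    Respects τ p ↔ (p.map τ).IsChain (· ≤ ·) := Iff.rfl

/-- A directed graph whose arcs strictly increase some rank function is acyclic. -/
theorem acyclic_of_rank (D : Dgraph Vt At) (r : Vt → ℕ)
    (hr : ∀ a, r (D.tail a) < r (D.head a)) : D.Acyclic := by
  have rank_le : ∀ (p : List At) (u v : Vt), D.WalkFrom u p v → r u ≤ r v := by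
    intro p
    induction p with
    | nil => rintro u v rfl; exact le_rfl
    | cons a p ih =>
      rintro u v ⟨rfl, h⟩
      exact (hr a).le.trans (ih _ _ h)
  rintro ⟨v, p, hp, -, hw⟩
  cases p with
  | nil => exact hp rfl
  | cons a p =>
    obtain ⟨ha, h⟩ := hw
    have := rank_le p _ _ h
    have := hr a
    rw [ha] at this
    omega

/-- A system of `k` disjoint τ-respecting paths to a non-root vertex bounds `lambdaT` below. -/
theorem HasTPaths.le_lambdaT [DecidableEq Vt] [Fintype At] {D : Dgraph Vt At} {τ : At → ℕ}
    {s v : Vt} {k : ℕ} (h : D.HasTPaths τ s v k) (hv : v ≠ s) : k ≤ D.lambdaT τ s v := by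
  refine le_csSup ⟨Fintype.card At, ?_⟩ h
  rintro l ⟨P, hP, hd⟩
  have hne : ∀ i, ∃ a, a ∈ P i := by
    intro i
    refine List.exists_mem_of_ne_nil _ fun h0 => hv ?_
    have := (hP i).1.1
    rw [h0] at this
    exact this.symm
  choose f hf using hne
  have hinj : Function.Injective f := by
    intro i j hij
    by_contra hne
    exact hd i j hne _ (hf i) (hij ▸ hf j)
  simpa using Fintype.card_le_of_injective f hinj

/-- A spanning arborescence has an arc entering each non-root vertex. -/
theorem IsArb.exists_head_eq [DecidableEq Vt] [Fintype Vt] [Fintype At] {D : Dgraph Vt At}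
    {s : Vt} {B : Finset At} (h : D.IsArb s B) (hs : D.vertsF s B = Finset.univ) {v : Vt}
    (hv : v ≠ s) : ∃ a ∈ B, D.head a = v := by
  have h1 := h.2 v (hs ▸ Finset.mem_univ v) hv
  obtain ⟨a, ha⟩ := Finset.card_pos.1 (h1 ▸ Nat.one_pos : 0 < D.indegOn B v)
  exact ⟨a, Finset.mem_filter.1 ha⟩

end Dgraph

namespace HypergraphNetwork

/-- The root, `2 * k` points, and the injective `k`-tuples of points. -/
abbrev Vert (k : ℕ) := Option (Fin (2 * k) ⊕ (Fin k ↪ Fin (2 * k)))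

/-- One early arc and `k` late arcs from the root to every point, and an arc from every entry of
a tuple to that tuple. -/
abbrev Arc (k : ℕ) := Fin (2 * k) ⊕ (Fin (2 * k) × Fin k) ⊕ ((Fin k ↪ Fin (2 * k)) × Fin k)

variable {k : ℕ}

def tail : Arc k → Vert k
  | .inl _ => none
  | .inr (.inl _) => none
  | .inr (.inr (f, i)) => some (.inl (f i))

def head : Arc k → Vert k
  | .inl x => some (.inl x)
  | .inr (.inl (x, _)) => some (.inl x)
  | .inr (.inr (f, _)) => some (.inr f)

/-- Early arcs, arcs entering tuples, and late arcs have labels `0`, `1`, `2` respectively. -/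
def time : Arc k → ℕ
  | .inl _ => 0
  | .inr (.inl _) => 2
  | .inr (.inr _) => 1

def rank : Vert k → ℕ
  | none => 0
  | some (.inl _) => 1
  | some (.inr _) => 2

variable {n m : ℕ} (eV : Vert k ≃ Fin n) (eA : Arc k ≃ Fin m)

/-- The network with its vertices and arcs numbered. -/
def graph : Dgraph (Fin n) (Fin m) where
  tail a := eV (tail (eA.symm a))
  head a := eV (head (eA.symm a))

def label (a : Fin m) : ℕ := time (eA.symm a)

theorem head_ne_root (a : Fin m) : (graph eV eA).head a ≠ eV none := by
  obtain ⟨a, rfl⟩ := eA.surjective a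
  rcases a with x | ⟨x, j⟩ | ⟨f, i⟩ <;> simp [graph, head]

theorem acyclic : (graph eV eA).Acyclic := by
  refine Dgraph.acyclic_of_rank _ (fun v => rank (eV.symm v)) fun a => ?_
  obtain ⟨a, rfl⟩ := eA.surjective a
  rcases a with x | ⟨x, j⟩ | ⟨f, i⟩ <;> simp [graph, head, tail, rank]

theorem hasTPaths {v : Fin n} (hv : v ≠ eV none) :
    (graph eV eA).HasTPaths (label eA) (eV none) v k := by
  obtain ⟨v, rfl⟩ := eV.surjective v
  rcases v with _ | x | f
  · exact absurd rfl hv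
  · refine ⟨fun j => [eA (.inr (.inl (x, j)))], fun j => ?_, fun i j hij => ?_⟩
    · simp [Dgraph.IsPath, Dgraph.WalkFrom, Dgraph.walkVerts, Dgraph.respects_iff, graph, tail, head]
    · simpa using hij
  · refine ⟨fun i => [eA (.inl (f i)), eA (.inr (.inr (f, i)))], fun j => ?_, fun i j hij => ?_⟩
    · simp [Dgraph.IsPath, Dgraph.WalkFrom, Dgraph.walkVerts, Dgraph.respects_iff, graph, tail, head,
        label, time]
    · simpa using hij

/-- A spanning τ-respecting arborescence reaches each tuple through an early arc. -/
theorem exists_early_mem {B : Finset (Fin m)}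
    (hB : (graph eV eA).IsTArb (label eA) (eV none) B)
    (hs : (graph eV eA).vertsF (eV none) B = Finset.univ) (f : Fin k ↪ Fin (2 * k)) :
    ∃ i, eA (.inl (f i)) ∈ B := by
  obtain ⟨a, haB, ha⟩ := hB.1.exists_head_eq hs (v := eV (some (.inr f))) (by simp)
  obtain ⟨a, rfl⟩ := eA.surjective a
  rcases a with x | ⟨x, j⟩ | ⟨g, i⟩
  · simp [graph, head] at ha
  · simp [graph, head] at ha
  obtain rfl : g = f := by simpa [graph, head] using ha
  refine ⟨i, ?_⟩
  obtain ⟨b, hbB, hb⟩ := hB.1.exists_head_eq hs (v := eV (some (.inl (g i)))) (by simp)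
  obtain ⟨b, rfl⟩ := eA.surjective b
  rcases b with x | ⟨x, j⟩ | _
  · obtain rfl : x = g i := by simpa [graph, head] using hb
    exact hbB
  · obtain rfl : x = g i := by simpa [graph, head] using hb
    have h := hB.2 (eV (some (.inr g))) (hs ▸ Finset.mem_univ _)
      [eA (.inr (.inl (g i, j))), eA (.inr (.inr (g, i)))] (by simp [haB, hbB])
      (by simp [Dgraph.IsPath, Dgraph.WalkFrom, Dgraph.walkVerts, graph, tail, head])
    simp [Dgraph.respects_iff, label, time] at h
  · simp [graph, head] at hb

/-- Every 2-colouring of `2 * k` points has a monochromatic injective `k`-tuple. -/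
theorem exists_monochromatic (c : Fin (2 * k) → Bool) :
    ∃ (f : Fin k ↪ Fin (2 * k)) (b : Bool), ∀ i, c (f i) = b := by
  obtain ⟨b, hb⟩ := Fintype.exists_le_card_fiber_of_mul_le_card c (n := k) (by simp)
  obtain ⟨f⟩ := Function.Embedding.nonempty_of_card_le (α := Fin k)
    (β := {x // c x = b}) (by simpa [Fintype.card_subtype] using hb)
  exact ⟨f.trans (Function.Embedding.subtype _), b, fun i => (f i).2⟩

end HypergraphNetwork


/-- For every positive integer `k` there exists an acyclic temporal network
`N = ((V ∪ {s}, A), τ)` with `λ_N(s,v) ≥ k` for all `v ∈ V` which contains no packing of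
`2` spanning τ-respecting `s`-arborescences. -/
theorem exists_acyclic_highly_connected_no_two_spanning (k : ℕ) (hk : 0 < k) :
    ∃ (n m : ℕ) (D : Dgraph (Fin n) (Fin m)) (τ : Fin m → ℕ) (s : Fin n),
      (∀ a : Fin m, D.head a ≠ s) ∧
      D.Acyclic ∧
      (∀ v : Fin n, v ≠ s → k ≤ D.lambdaT τ s v) ∧
      ¬ ∃ B₁ B₂ : Finset (Fin m), Disjoint B₁ B₂ ∧
          D.IsTArb τ s B₁ ∧ D.vertsF s B₁ = Finset.univ ∧
          D.IsTArb τ s B₂ ∧ D.vertsF s B₂ = Finset.univ := by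
  classical
  let eV := Fintype.equivFin (HypergraphNetwork.Vert k)
  let eA := Fintype.equivFin (HypergraphNetwork.Arc k)
  refine ⟨_, _, HypergraphNetwork.graph eV eA, HypergraphNetwork.label eA, eV none,
    HypergraphNetwork.head_ne_root eV eA, HypergraphNetwork.acyclic eV eA,
    fun v hv => (HypergraphNetwork.hasTPaths eV eA hv).le_lambdaT hv, ?_⟩
  rintro ⟨B₁, B₂, hd, h₁, hs₁, h₂, hs₂⟩
  obtain ⟨f, b, hf⟩ :=
    HypergraphNetwork.exists_monochromatic fun x => decide (eA (.inl x) ∈ B₁)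
  obtain ⟨i, hi⟩ := HypergraphNetwork.exists_early_mem eV eA h₁ hs₁ f
  obtain ⟨j, hj⟩ := HypergraphNetwork.exists_early_mem eV eA h₂ hs₂ f
  have hj₁ : eA (.inl (f j)) ∈ B₁ := by
    have := (hf j).trans (hf i).symm
    simpa [hi] using this
  exact Finset.disjoint_left.1 hd hj₁ hj
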